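/- Let the coefficients {a_v}_{v∈𝒱} be a uniform random point of the sphere of radius √2 in ℝ^𝒱, independent of X, and let f(x) = Re(Σ_{v∈𝒱} a_v e^{2πi⟨Bv,x⟩}). Then for every µ > 0, 𝔼_a[ d_TV(f(X), Z) ] ≤ (1/µ) · [ √( (8(2π)⁴/(|𝒱|(|𝒱|+2))) · Σ_{v,w∈𝒱} (v,w)_B² ) + (2√2 + √π) · √( (1/|𝒱|) Σ_{v∈𝒱} (µ_v − µ)² ) ], where the total variation distance is computed for fixed coefficients a (conditionally on a) and then averaged over a. -/

import Mathlib

open MeasureTheory ProbabilityTheory Real Finset Matrix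

noncomputable section

/-- total variation distance between two (Borel) measures on ℝ -/
def dTV (μ ν : MeasureTheory.Measure ℝ) : ℝ :=
  ⨆ s : {s : Set ℝ // MeasurableSet s}, |(μ s.1).toReal - (ν s.1).toReal|

/-- uniform probability measure on the unit sphere of a Euclidean space -/
def sphereUniform (ι : Type*) [Fintype ι] :
    MeasureTheory.Measure (Metric.sphere (0 : EuclideanSpace ℝ ι) 1) :=
  ((volume : MeasureTheory.Measure (EuclideanSpace ℝ ι)).toSphere Set.univ)⁻¹ •
    (volume : MeasureTheory.Measure (EuclideanSpace ℝ ι)).toSphere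

/-- the uniform probability measure on the flat torus `ℝ^n/ℤ^n`, modelled by Lebesgue
measure on the fundamental domain `[0,1)^n`. -/
def torusMeasure (n : ℕ) : MeasureTheory.Measure (Fin n → ℝ) :=
  volume.restrict (Set.univ.pi fun _ => Set.Ico (0 : ℝ) 1)

/-- the uniform probability distribution of the coefficients: a uniform random point of
the sphere of radius `√2` in `ℝ^𝒱`. -/
def coeffMeasure {n : ℕ} (𝒱 : Finset (Fin n → ℝ)) : MeasureTheory.Measure (↥𝒱 → ℝ) :=
  MeasureTheory.Measure.map
    (fun c : Metric.sphere (0 : EuclideanSpace ℝ ↥𝒱) 1 =>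
      fun v => Real.sqrt 2 * (c : EuclideanSpace ℝ ↥𝒱) v)
    (sphereUniform ↥𝒱)

/-- `f(x) = Re ∑_{v ∈ 𝒱} a_v e^{2πi⟨Bv,x⟩}` -/
def torusFun {n : ℕ} (B : Matrix (Fin n) (Fin n) ℝ) (𝒱 : Finset (Fin n → ℝ))
    (a : ↥𝒱 → ℝ) (x : Fin n → ℝ) : ℝ :=
  (∑ v : ↥𝒱, (a v : ℂ) *
    Complex.exp (2 * π * Complex.I * ((B.mulVec v ⬝ᵥ x : ℝ) : ℂ))).re

/-- `∇_B f(x) = −Im(∑_{v∈𝒱} 2π a_v e^{2πi⟨Bv,x⟩} v)` -/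
def gradB {n : ℕ} (B : Matrix (Fin n) (Fin n) ℝ) (𝒱 : Finset (Fin n → ℝ))
    (a : ↥𝒱 → ℝ) (x : Fin n → ℝ) : Fin n → ℝ := fun k =>
  -(∑ v : ↥𝒱, 2 * π * (a v : ℂ) *
      Complex.exp (2 * π * Complex.I * ((B.mulVec v ⬝ᵥ x : ℝ) : ℂ)) *
      ((v : Fin n → ℝ) k : ℂ)).im

/-- `‖w‖_B² = ⟨Bw,w⟩` -/
def normBsq {n : ℕ} (B : Matrix (Fin n) (Fin n) ℝ) (w : Fin n → ℝ) : ℝ :=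
  B.mulVec w ⬝ᵥ w

end

/-- The self-map of the unit sphere induced by a linear isometry. -/
def sphereMap {E : Type*} [NormedAddCommGroup E] [InnerProductSpace ℝ E] (e : E ≃ₗᵢ[ℝ] E)
    (c : Metric.sphere (0 : E) 1) : Metric.sphere (0 : E) 1 :=
  ⟨e c, by simp⟩

lemma continuous_sphereMap {E : Type*} [NormedAddCommGroup E] [InnerProductSpace ℝ E]
    (e : E ≃ₗᵢ[ℝ] E) : Continuous (sphereMap e) :=
  Continuous.subtype_mk (e.continuous.comp continuous_subtype_val) _

open scoped Pointwise in
lemma measurePreserving_sphereMap {E : Type*} [NormedAddCommGroup E] [InnerProductSpace ℝ E]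
    [FiniteDimensional ℝ E] [MeasurableSpace E] [BorelSpace E] (e : E ≃ₗᵢ[ℝ] E) :
    MeasurePreserving (sphereMap e) (volume : Measure E).toSphere
      (volume : Measure E).toSphere := by
  refine ⟨(continuous_sphereMap e).measurable, ?_⟩
  ext s hs
  have hT := (continuous_sphereMap e).measurable
  rw [Measure.map_apply hT hs, Measure.toSphere_apply' _ (hT hs), Measure.toSphere_apply' _ hs]
  congr 1
  have hp : MeasurePreserving e.toMeasurableEquiv (volume : Measure E) volume :=
    e.measurePreserving
  rw [← hp.measure_preimage_equiv (Set.Ioo (0 : ℝ) 1 • (Subtype.val '' s))]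
  congr 1
  ext x
  simp only [Set.mem_smul, Set.mem_image, Set.mem_preimage]
  constructor
  · rintro ⟨r, hr, _, ⟨c, hc, rfl⟩, rfl⟩
    exact ⟨r, hr, _, ⟨_, hc, rfl⟩, by simp [sphereMap]⟩
  · rintro ⟨r, hr, _, ⟨c, hc, rfl⟩, h⟩
    refine ⟨r, hr, _, ⟨sphereMap e.symm c, ?_, rfl⟩, ?_⟩
    · have : sphereMap e (sphereMap e.symm c) = c := by ext; simp [sphereMap]
      rwa [this]
    · apply e.injective
      simpa [sphereMap] using h

section SphereMoments

variable {ι : Type*} [Fintype ι]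

instance sphereUniform.isProbabilityMeasure [Nonempty ι] :
    IsProbabilityMeasure (sphereUniform ι) := by
  refine ⟨?_⟩
  rw [sphereUniform, Measure.smul_apply, smul_eq_mul]
  exact ENNReal.inv_mul_cancel (Measure.measure_univ_ne_zero.2 (Measure.toSphere_ne_zero _))
    (measure_ne_top _ _)

lemma measurePreserving_sphereUniform
    (e : EuclideanSpace ℝ ι ≃ₗᵢ[ℝ] EuclideanSpace ℝ ι) :
    MeasurePreserving (sphereMap e) (sphereUniform ι) (sphereUniform ι) :=
  (measurePreserving_sphereMap e).smul_measure _

lemma integrable_sphereUniform [Nonempty ι] {f : EuclideanSpace ℝ ι → ℝ} (hf : Continuous f) :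
    Integrable (fun c : Metric.sphere (0 : EuclideanSpace ℝ ι) 1 => f c) (sphereUniform ι) :=
  (hf.comp continuous_subtype_val).integrable_of_hasCompactSupport
    (HasCompactSupport.of_compactSpace _)

lemma integral_sphereUniform_inner_pow_congr [Nonempty ι] (k : ℕ) {u w : EuclideanSpace ℝ ι}
    (h : ‖u‖ = ‖w‖) :
    ∫ c, (inner ℝ (c : EuclideanSpace ℝ ι) u) ^ k ∂(sphereUniform ι) =
      ∫ c, (inner ℝ (c : EuclideanSpace ℝ ι) w) ^ k ∂(sphereUniform ι) := by
  set e := Submodule.reflection (ℝ ∙ (w - u))ᗮ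
  have he : e w = u := Submodule.reflection_sub h.symm
  have hm := measurePreserving_sphereUniform e
  conv_rhs => rw [← hm.map_eq]
  rw [← he, integral_map hm.measurable.aemeasurable]
  · refine integral_congr_ae (Filter.Eventually.of_forall fun c => ?_)
    simp only [sphereMap]
    rw [← e.inner_map_map (c : EuclideanSpace ℝ ι) (e w)]
    simp [e]
  · rw [hm.map_eq]
    exact (integrable_sphereUniform (f := fun c => (inner ℝ c w) ^ k)
      (by fun_prop)).aestronglyMeasurable

lemma exists_integral_sphereUniform_inner_pow [Nonempty ι] (k : ℕ) :
    ∃ m : ℝ, ∀ u : EuclideanSpace ℝ ι,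
      ∫ c, (inner ℝ (c : EuclideanSpace ℝ ι) u) ^ k ∂(sphereUniform ι) = m * ‖u‖ ^ k := by
  classical
  obtain ⟨i⟩ := ‹Nonempty ι›
  have : Nonempty ι := ⟨i⟩
  refine ⟨∫ c, (inner ℝ (c : EuclideanSpace ℝ ι) (EuclideanSpace.single i 1)) ^ k
    ∂(sphereUniform ι), fun u => ?_⟩
  rw [integral_sphereUniform_inner_pow_congr k
    (w := ‖u‖ • EuclideanSpace.single i (1 : ℝ)) (by simp [norm_smul]), ← integral_mul_const]
  simp [inner_smul_right, mul_pow, mul_comm]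

lemma exists_integral_sphereUniform_mul_mul_mul [Nonempty ι] :
    ∃ m : ℝ, ∀ p q r s : EuclideanSpace ℝ ι,
      ∫ c, inner ℝ (c : EuclideanSpace ℝ ι) p * inner ℝ (c : EuclideanSpace ℝ ι) q *
          inner ℝ (c : EuclideanSpace ℝ ι) r * inner ℝ (c : EuclideanSpace ℝ ι) s
          ∂(sphereUniform ι) =
        m * (inner ℝ p q * inner ℝ r s + inner ℝ p r * inner ℝ q s +
          inner ℝ p s * inner ℝ q r) := by
  obtain ⟨m, hm⟩ := exists_integral_sphereUniform_inner_pow (ι := ι) 4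
  refine ⟨m / 3, fun p q r s => ?_⟩
  have hpol : ∀ c : EuclideanSpace ℝ ι,
      inner ℝ c p * inner ℝ c q * inner ℝ c r * inner ℝ c s =
      (1 / 192) * ((inner ℝ c (p + q + r + s)) ^ 4 - (inner ℝ c (p + q + r - s)) ^ 4
        - (inner ℝ c (p + q - r + s)) ^ 4 - (inner ℝ c (p - q + r + s)) ^ 4
        + (inner ℝ c (p + q - r - s)) ^ 4 + (inner ℝ c (p - q + r - s)) ^ 4
        + (inner ℝ c (p - q - r + s)) ^ 4 - (inner ℝ c (p - q - r - s)) ^ 4) := by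
    intro c
    simp only [inner_add_right, inner_sub_right]
    ring
  have hi : ∀ u : EuclideanSpace ℝ ι, Integrable
      (fun c : Metric.sphere (0 : EuclideanSpace ℝ ι) 1 =>
        (inner ℝ (c : EuclideanSpace ℝ ι) u) ^ 4) (sphereUniform ι) := fun u =>
    integrable_sphereUniform (f := fun c => (inner ℝ c u) ^ 4) (by fun_prop)
  have hn : ∀ u : EuclideanSpace ℝ ι, ‖u‖ ^ 4 = (inner ℝ u u) ^ 2 := fun u => by
    rw [real_inner_self_eq_norm_sq]; ring
  simp only [hpol]
  rw [integral_const_mul, integral_sub, integral_add, integral_add, integral_add, integral_sub,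
    integral_sub, integral_sub]
  · simp only [hm, hn]
    simp only [inner_add_right, inner_sub_right, inner_add_left, inner_sub_left,
      real_inner_comm p, real_inner_comm q r, real_inner_comm q s, real_inner_comm r s]
    ring
  all_goals fun_prop (disch := assumption)

lemma exists_integral_sphereUniform_mul [Nonempty ι] :
    ∃ m : ℝ, ∀ p q : EuclideanSpace ℝ ι,
      ∫ c, inner ℝ (c : EuclideanSpace ℝ ι) p * inner ℝ (c : EuclideanSpace ℝ ι) q
          ∂(sphereUniform ι) = m * inner ℝ p q := by
  obtain ⟨m, hm⟩ := exists_integral_sphereUniform_inner_pow (ι := ι) 2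
  refine ⟨m, fun p q => ?_⟩
  have hpol : ∀ c : EuclideanSpace ℝ ι, inner ℝ c p * inner ℝ c q =
      (1 / 4) * ((inner ℝ c (p + q)) ^ 2 - (inner ℝ c (p - q)) ^ 2) := by
    intro c
    simp only [inner_add_right, inner_sub_right]
    ring
  have hi : ∀ u : EuclideanSpace ℝ ι, Integrable
      (fun c : Metric.sphere (0 : EuclideanSpace ℝ ι) 1 =>
        (inner ℝ (c : EuclideanSpace ℝ ι) u) ^ 2) (sphereUniform ι) := fun u =>
    integrable_sphereUniform (f := fun c => (inner ℝ c u) ^ 2) (by fun_prop)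
  simp only [hpol]
  rw [integral_const_mul, integral_sub (hi _) (hi _), hm, hm,
    ← real_inner_self_eq_norm_sq, ← real_inner_self_eq_norm_sq]
  simp only [inner_add_right, inner_sub_right, inner_add_left, inner_sub_left,
    real_inner_comm p q]
  ring

lemma sum_sq_of_mem_sphere (c : Metric.sphere (0 : EuclideanSpace ℝ ι) 1) :
    ∑ i, (c : EuclideanSpace ℝ ι) i ^ 2 = 1 := by
  rw [← EuclideanSpace.real_norm_sq_eq]
  simp

variable [DecidableEq ι]

lemma integral_sphereUniform_coord_mul [Nonempty ι] (i j : ι) :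
    ∫ c, (c : EuclideanSpace ℝ ι) i * (c : EuclideanSpace ℝ ι) j ∂(sphereUniform ι) =
      1 / Fintype.card ι * if i = j then 1 else 0 := by
  obtain ⟨m, hm⟩ := exists_integral_sphereUniform_mul (ι := ι)
  have h : ∀ i j : ι, ∫ c, (c : EuclideanSpace ℝ ι) i * (c : EuclideanSpace ℝ ι) j
      ∂(sphereUniform ι) = m * if i = j then 1 else 0 := fun i j => by
    simpa [EuclideanSpace.inner_single_right, PiLp.single_apply, eq_comm]
      using hm (EuclideanSpace.single i 1) (EuclideanSpace.single j 1)
  have h1 : ∫ c, (∑ i, (c : EuclideanSpace ℝ ι) i ^ 2) ∂(sphereUniform ι) = 1 := by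
    simp [sum_sq_of_mem_sphere]
  rw [integral_finsetSum _ fun i _ => integrable_sphereUniform
    (f := fun c => c i ^ 2) (by fun_prop)] at h1
  simp only [sq, h] at h1
  simp only [if_true, mul_one, sum_const, card_univ, nsmul_eq_mul] at h1
  rw [h, ← h1]
  have : (Fintype.card ι : ℝ) ≠ 0 := by simp
  field_simp

lemma integral_sphereUniform_coord_mul_mul_mul [Nonempty ι] (i j k l : ι) :
    ∫ c, (c : EuclideanSpace ℝ ι) i * (c : EuclideanSpace ℝ ι) j *
        (c : EuclideanSpace ℝ ι) k * (c : EuclideanSpace ℝ ι) l ∂(sphereUniform ι) =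
      1 / (Fintype.card ι * (Fintype.card ι + 2)) *
        ((if i = j then 1 else 0) * (if k = l then 1 else 0) +
          (if i = k then 1 else 0) * (if j = l then 1 else 0) +
          (if i = l then 1 else 0) * (if j = k then 1 else 0)) := by
  obtain ⟨m, hm⟩ := exists_integral_sphereUniform_mul_mul_mul (ι := ι)
  have h : ∀ i j k l : ι, ∫ c, (c : EuclideanSpace ℝ ι) i * (c : EuclideanSpace ℝ ι) j *
        (c : EuclideanSpace ℝ ι) k * (c : EuclideanSpace ℝ ι) l ∂(sphereUniform ι) =
      m * ((if i = j then 1 else 0) * (if k = l then 1 else 0) +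
          (if i = k then 1 else 0) * (if j = l then 1 else 0) +
          (if i = l then 1 else 0) * (if j = k then 1 else 0)) := fun i j k l => by
    simpa only [EuclideanSpace.inner_single_right, PiLp.single_apply, eq_comm,
      RCLike.conj_to_real, one_mul, map_one, map_zero, apply_ite]
      using hm (EuclideanSpace.single i 1) (EuclideanSpace.single j 1)
        (EuclideanSpace.single k 1) (EuclideanSpace.single l 1)
  have h1 : ∫ c, (∑ i, ∑ j, (c : EuclideanSpace ℝ ι) i * (c : EuclideanSpace ℝ ι) i *
      (c : EuclideanSpace ℝ ι) j * (c : EuclideanSpace ℝ ι) j) ∂(sphereUniform ι) = 1 := by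
    have : ∀ c : Metric.sphere (0 : EuclideanSpace ℝ ι) 1,
        (∑ i, ∑ j, (c : EuclideanSpace ℝ ι) i * (c : EuclideanSpace ℝ ι) i *
          (c : EuclideanSpace ℝ ι) j * (c : EuclideanSpace ℝ ι) j) = 1 := fun c => by
      calc _ = (∑ i, (c : EuclideanSpace ℝ ι) i ^ 2) * ∑ j, (c : EuclideanSpace ℝ ι) j ^ 2 := by
            rw [sum_mul_sum]
            exact sum_congr rfl fun i _ => sum_congr rfl fun j _ => by ring
        _ = 1 := by simp [sum_sq_of_mem_sphere]
    simp [this]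
  rw [integral_finsetSum _ fun i _ => integrable_sphereUniform
    (f := fun c => ∑ j, c i * c i * c j * c j) (by fun_prop)] at h1
  simp_rw [fun i => integral_finsetSum (μ := sphereUniform ι) univ fun j _ =>
    integrable_sphereUniform
    (f := fun c : EuclideanSpace ℝ ι => c i * c i * c j * c j) (by fun_prop), h] at h1
  have h2 : m * (Fintype.card ι * (Fintype.card ι + 2)) = 1 := by
    rw [← h1]
    simp [← mul_sum, sum_add_distrib]
    ring
  rw [h, eq_one_div_of_mul_eq_one_left h2]

end SphereMoments

section CoeffMoments

variable {n : ℕ} {𝒱 : Finset (Fin n → ℝ)}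

lemma measurable_sqrt_two_mul_sphere : Measurable
    (fun c : Metric.sphere (0 : EuclideanSpace ℝ ↥𝒱) 1 =>
      fun v => Real.sqrt 2 * (c : EuclideanSpace ℝ ↥𝒱) v) :=
  Continuous.measurable (by fun_prop)

lemma integral_coeffMeasure {f : (↥𝒱 → ℝ) → ℝ} (hf : Continuous f) :
    ∫ a, f a ∂(coeffMeasure 𝒱) =
      ∫ c, f (fun v => Real.sqrt 2 * (c : EuclideanSpace ℝ ↥𝒱) v) ∂(sphereUniform ↥𝒱) :=
  integral_map measurable_sqrt_two_mul_sphere.aemeasurable hf.aestronglyMeasurable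

variable [Nonempty ↥𝒱]

instance coeffMeasure.isProbabilityMeasure : IsProbabilityMeasure (coeffMeasure 𝒱) :=
  Measure.isProbabilityMeasure_map measurable_sqrt_two_mul_sphere.aemeasurable

lemma integrable_coeffMeasure {f : (↥𝒱 → ℝ) → ℝ} (hf : Continuous f) :
    Integrable f (coeffMeasure 𝒱) :=
  (integrable_map_measure hf.aestronglyMeasurable
    measurable_sqrt_two_mul_sphere.aemeasurable).2 <|
    integrable_sphereUniform
      (f := fun c => f (fun v => Real.sqrt 2 * c v)) (by fun_prop)

variable [DecidableEq ↥𝒱]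

lemma integral_coeffMeasure_mul (v w : ↥𝒱) :
    ∫ a, a v * a w ∂(coeffMeasure 𝒱) = 2 / #𝒱 * if v = w then 1 else 0 := by
  rw [integral_coeffMeasure (f := fun a => a v * a w) (by fun_prop)]
  have h : ∀ c : EuclideanSpace ℝ ↥𝒱,
      Real.sqrt 2 * c v * (Real.sqrt 2 * c w) = 2 * (c v * c w) := fun c => by
    linear_combination (c v * c w) * Real.mul_self_sqrt (show (0 : ℝ) ≤ 2 by norm_num)
  simp_rw [h, integral_const_mul, integral_sphereUniform_coord_mul, Fintype.card_coe]
  ring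

lemma integral_coeffMeasure_mul_mul_mul (v w x y : ↥𝒱) :
    ∫ a, a v * a w * (a x * a y) ∂(coeffMeasure 𝒱) =
      4 / (#𝒱 * (#𝒱 + 2)) *
        ((if v = w then 1 else 0) * (if x = y then 1 else 0) +
          (if v = x then 1 else 0) * (if w = y then 1 else 0) +
          (if v = y then 1 else 0) * (if w = x then 1 else 0)) := by
  rw [integral_coeffMeasure (f := fun a => a v * a w * (a x * a y)) (by fun_prop)]
  have h : ∀ c : EuclideanSpace ℝ ↥𝒱, Real.sqrt 2 * c v * (Real.sqrt 2 * c w) *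
      (Real.sqrt 2 * c x * (Real.sqrt 2 * c y)) = 4 * (c v * c w * c x * c y) := fun c => by
    have h2 := Real.mul_self_sqrt (show (0 : ℝ) ≤ 2 by norm_num)
    linear_combination (c v * c w * c x * c y) * (Real.sqrt 2 * Real.sqrt 2 + 2) * h2
  simp_rw [h, integral_const_mul, integral_sphereUniform_coord_mul_mul_mul, Fintype.card_coe]
  ring

lemma integral_coeffMeasure_quadratic (M : ↥𝒱 → ↥𝒱 → ℝ) :
    ∫ a, (∑ v, ∑ w, M v w * (a v * a w)) ∂(coeffMeasure 𝒱) = 2 / #𝒱 * ∑ v, M v v := by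
  rw [integral_finsetSum _ fun v _ => integrable_coeffMeasure (by fun_prop)]
  simp_rw [fun v => integral_finsetSum (μ := coeffMeasure 𝒱) univ fun w _ =>
    integrable_coeffMeasure (f := fun a => M v w * (a v * a w)) (by fun_prop),
    integral_const_mul, integral_coeffMeasure_mul]
  simp [mul_sum, mul_comm]

lemma integral_coeffMeasure_quadratic_sq (M : ↥𝒱 → ↥𝒱 → ℝ) (hM : ∀ v w, M v w = M w v) :
    ∫ a, (∑ v, ∑ w, M v w * (a v * a w)) ^ 2 ∂(coeffMeasure 𝒱) =
      4 / (#𝒱 * (#𝒱 + 2)) * ((∑ v, M v v) ^ 2 + 2 * ∑ v, ∑ w, M v w ^ 2) := by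
  have h : ∀ a : ↥𝒱 → ℝ, (∑ v, ∑ w, M v w * (a v * a w)) ^ 2 =
      ∑ p : (↥𝒱 × ↥𝒱) × (↥𝒱 × ↥𝒱), M p.1.1 p.1.2 * M p.2.1 p.2.2 *
        (a p.1.1 * a p.1.2 * (a p.2.1 * a p.2.2)) := fun a => by
    rw [sq, Fintype.sum_prod_type, ← Fintype.sum_prod_type', sum_mul_sum]
    exact sum_congr rfl fun p _ => sum_congr rfl fun q _ => by ring
  simp_rw [h]
  rw [integral_finsetSum _ fun p _ => integrable_coeffMeasure (by fun_prop)]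
  simp_rw [integral_const_mul, integral_coeffMeasure_mul_mul_mul, Fintype.sum_prod_type]
  have h1 : ∑ v, ∑ w, ∑ x, ∑ y, M v w * M x y *
      ((if v = w then (1 : ℝ) else 0) * (if x = y then 1 else 0)) = (∑ v, M v v) ^ 2 := by
    simp [sq, sum_mul_sum]
  have h2 : ∑ v, ∑ w, ∑ x, ∑ y, M v w * M x y *
      ((if v = x then (1 : ℝ) else 0) * (if w = y then 1 else 0)) = ∑ v, ∑ w, M v w ^ 2 := by
    simp [sq]
  have h3 : ∑ v, ∑ w, ∑ x, ∑ y, M v w * M x y *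
      ((if v = y then (1 : ℝ) else 0) * (if w = x then 1 else 0)) = ∑ v, ∑ w, M v w ^ 2 := by
    simp [sq]
    exact sum_congr rfl fun v _ => sum_congr rfl fun w _ => by rw [hM w v]
  rw [two_mul, ← add_assoc, ← h1]
  nth_rw 1 [← h2]
  rw [← h3]
  simp only [mul_sum, ← sum_add_distrib]
  exact sum_congr rfl fun v _ => sum_congr rfl fun w _ => sum_congr rfl fun x _ =>
    sum_congr rfl fun y _ => by ring

end CoeffMoments

section Stein

lemma integral_Ioi_exp_neg_sq_div_two_le {x : ℝ} (hx : 0 ≤ x) :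
    ∫ t in Set.Ioi x, Real.exp (-(1 / 2) * t ^ 2) ≤
      Real.exp (-(1 / 2) * x ^ 2) * Real.sqrt (π / 2) := by
  have hi : Integrable fun t : ℝ => Real.exp (-(1 / 2) * t ^ 2) :=
    integrable_exp_neg_mul_sq (by norm_num)
  have h0 : ∫ t in Set.Ioi (0 : ℝ), Real.exp (-(1 / 2) * t ^ 2) = Real.sqrt (π / 2) := by
    rw [integral_gaussian_Ioi, show π / (1 / 2) = π / 2 * 2 ^ 2 by ring,
      Real.sqrt_mul (by positivity), Real.sqrt_sq (by norm_num)]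
    ring
  have hs : ∫ t in Set.Ioi x, Real.exp (-(1 / 2) * t ^ 2) =
      ∫ t in Set.Ioi (0 : ℝ), Real.exp (-(1 / 2) * (t + x) ^ 2) := by
    rw [← (measurePreserving_add_right volume x).setIntegral_preimage_emb
      (measurableEmbedding_addRight x)]
    simp
  rw [hs, ← h0, ← integral_const_mul]
  refine setIntegral_mono_on ?_ (hi.const_mul _).integrableOn measurableSet_Ioi fun t ht => ?_
  · exact (hi.comp_add_right x).integrableOn
  · rw [← Real.exp_add]
    refine Real.exp_le_exp.2 ?_
    nlinarith [mul_nonneg hx (le_of_lt (Set.mem_Ioi.1 ht))]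

lemma mul_integral_Ioi_exp_neg_sq_div_two_le {x : ℝ} (hx : 0 ≤ x) :
    x * ∫ t in Set.Ioi x, Real.exp (-(1 / 2) * t ^ 2) ≤ Real.exp (-(1 / 2) * x ^ 2) := by
  have hd : ∀ t ∈ Set.Ici x, HasDerivAt (fun t : ℝ => -Real.exp (-(1 / 2) * t ^ 2))
      (t * Real.exp (-(1 / 2) * t ^ 2)) t := fun t _ => by
    refine (((hasDerivAt_pow 2 t).const_mul (-(1 / 2) : ℝ)).exp).neg.congr_deriv ?_
    push_cast
    ring
  have hlim : Filter.Tendsto (fun t : ℝ => -Real.exp (-(1 / 2) * t ^ 2)) Filter.atTop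
      (nhds 0) := by
    rw [← neg_zero]
    refine (Real.tendsto_exp_atBot.comp ?_).neg
    exact (Filter.tendsto_pow_atTop two_ne_zero).const_mul_atTop_of_neg (by norm_num)
  have hpos : ∀ t ∈ Set.Ioi x, 0 ≤ t * Real.exp (-(1 / 2) * t ^ 2) := fun t ht =>
    mul_nonneg (hx.trans (le_of_lt ht)) (Real.exp_nonneg _)
  have hval := integral_Ioi_of_hasDerivAt_of_nonneg' hd hpos hlim
  have hint := integrableOn_Ioi_deriv_of_nonneg' hd hpos hlim
  rw [zero_sub, neg_neg] at hval
  rw [← hval, ← integral_const_mul]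
  refine setIntegral_mono_on ?_ hint measurableSet_Ioi fun t ht => ?_
  · exact ((integrable_exp_neg_mul_sq (by norm_num)).const_mul _).integrableOn
  · exact mul_le_mul_of_nonneg_right (le_of_lt ht) (Real.exp_nonneg _)

lemma abs_mul_exp_bounds {x A : ℝ}
    (hA : |A| ≤ ∫ t in Set.Ioi |x|, Real.exp (-(1 / 2) * t ^ 2)) :
    |Real.exp (1 / 2 * x ^ 2) * A| ≤ Real.sqrt (π / 2) ∧
      |x * (Real.exp (1 / 2 * x ^ 2) * A)| ≤ 1 := by
  have hexp : Real.exp (1 / 2 * x ^ 2) * Real.exp (-(1 / 2) * |x| ^ 2) = 1 := by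
    rw [← Real.exp_add, sq_abs]
    simp
  have h1 := hA.trans (integral_Ioi_exp_neg_sq_div_two_le (abs_nonneg x))
  have h2 := (mul_le_mul_of_nonneg_left hA (abs_nonneg x)).trans
    (mul_integral_Ioi_exp_neg_sq_div_two_le (abs_nonneg x))
  have hp := Real.exp_pos (1 / 2 * x ^ 2)
  constructor
  · rw [abs_mul, abs_of_pos hp]
    calc _ ≤ _ := mul_le_mul_of_nonneg_left h1 hp.le
      _ = Real.sqrt (π / 2) := by rw [← mul_assoc, hexp, one_mul]
  · rw [abs_mul, abs_mul, abs_of_pos hp]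
    calc _ = Real.exp (1 / 2 * x ^ 2) * (|x| * |A|) := by ring
      _ ≤ _ := mul_le_mul_of_nonneg_left h2 hp.le
      _ = 1 := hexp

/-- Bounded solutions of Stein's equation for a continuous centred test function. -/
lemma exists_stein_solution {h : ℝ → ℝ} (hc : Continuous h) (hb : ∀ x, |h x| ≤ 1)
    (h0 : ∫ x, h x ∂(gaussianReal 0 1) = 0) :
    ∃ g : ℝ → ℝ, (∀ x, HasDerivAt g (x * g x + h x) x) ∧
      (∀ x, |g x| ≤ Real.sqrt (π / 2)) ∧ ∀ x, |x * g x + h x| ≤ 2 := by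
  have hi : Integrable fun t : ℝ => Real.exp (-(1 / 2) * t ^ 2) :=
    integrable_exp_neg_mul_sq (by norm_num)
  set φ : ℝ → ℝ := fun t => h t * Real.exp (-(1 / 2) * t ^ 2) with hφ
  have hφc : Continuous φ := by fun_prop
  have hφb : ∀ t, ‖φ t‖ ≤ Real.exp (-(1 / 2) * t ^ 2) := fun t => by
    rw [hφ, norm_mul, Real.norm_eq_abs, Real.norm_eq_abs, Real.abs_exp]
    exact mul_le_of_le_one_left (Real.exp_nonneg _) (hb t)
  have hφi : Integrable φ := hi.mono' hφc.aestronglyMeasurable (Filter.Eventually.of_forall hφb)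
  have hφ0 : ∫ t, φ t = 0 := by
    rw [integral_gaussianReal_eq_integral_smul one_ne_zero] at h0
    have h1 : ∀ t, gaussianPDFReal 0 1 t • h t = (Real.sqrt (2 * π))⁻¹ * φ t := fun t => by
      simp only [gaussianPDFReal, hφ, smul_eq_mul, NNReal.coe_one, mul_one, sub_zero]
      rw [show -t ^ 2 / 2 = -(1 / 2) * t ^ 2 by ring]
      ring
    simp_rw [h1, integral_const_mul] at h0
    exact (mul_eq_zero.1 h0).resolve_left (by positivity)
  set F : ℝ → ℝ := fun x => ∫ t in Set.Iic x, φ t with hF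
  have hFd : ∀ x, HasDerivAt F (φ x) x := fun x => by
    have hFx : F = fun x => F 0 + ∫ t in (0 : ℝ)..x, φ t := by
      funext y
      rw [← intervalIntegral.integral_Iic_sub_Iic hφi.integrableOn hφi.integrableOn]
      simp [hF]
    rw [hFx]
    exact (intervalIntegral.integral_hasDerivAt_right (hφc.intervalIntegrable _ _)
      hφc.stronglyMeasurable.stronglyMeasurableAtFilter hφc.continuousAt).const_add _
  have hFb : ∀ x, |F x| ≤ ∫ t in Set.Ioi |x|, Real.exp (-(1 / 2) * t ^ 2) := fun x => by
    rcases le_total 0 x with hx | hx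
    · have hFx : F x = -∫ t in Set.Ioi x, φ t := by
        have := intervalIntegral.integral_Iic_add_Ioi (b := x) hφi.integrableOn hφi.integrableOn
        rw [hφ0] at this
        exact eq_neg_of_add_eq_zero_left this
      rw [hFx, abs_neg, abs_of_nonneg hx]
      exact norm_integral_le_of_norm_le hi.integrableOn (Filter.Eventually.of_forall hφb)
    · rw [abs_of_nonpos hx,
        ← integral_comp_neg_Iic x (fun t => Real.exp (-(1 / 2) * t ^ 2))]
      simp only [even_two.neg_pow]
      exact norm_integral_le_of_norm_le hi.integrableOn (Filter.Eventually.of_forall hφb)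
  refine ⟨fun x => Real.exp (1 / 2 * x ^ 2) * F x, fun x => ?_, fun x =>
    (abs_mul_exp_bounds (hFb x)).1, fun x => ?_⟩
  · have he : HasDerivAt (fun x : ℝ => Real.exp (1 / 2 * x ^ 2))
        (Real.exp (1 / 2 * x ^ 2) * x) x := by
      refine ((hasDerivAt_pow 2 x).const_mul (1 / 2 : ℝ)).exp.congr_deriv ?_
      simp
    refine (he.mul (hFd x)).congr_deriv ?_
    have hexp : Real.exp (1 / 2 * x ^ 2) * Real.exp (-(1 / 2) * x ^ 2) = 1 := by
      rw [← Real.exp_add]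
      simp
    simp only [hφ]
    linear_combination h x * hexp
  · calc _ ≤ _ := abs_add_le _ _
      _ ≤ 1 + 1 := add_le_add (abs_mul_exp_bounds (hFb x)).2 (hb x)
      _ = 2 := by norm_num

end Stein

section TotalVariation

lemma measureReal_sub_le_of_forall_continuous {P Q : Measure ℝ} [IsProbabilityMeasure P]
    [IsProbabilityMeasure Q] {C : ℝ}
    (hC : ∀ h : ℝ → ℝ, Continuous h → (∀ x, 0 ≤ h x) → (∀ x, h x ≤ 1) →
      ∫ x, h x ∂P - ∫ x, h x ∂Q ≤ C) {s : Set ℝ} (hs : MeasurableSet s) :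
    P.real s - Q.real s ≤ C := by
  have hclosed : ∀ F : Set ℝ, IsClosed F → P.real F - Q.real F ≤ C := fun F hF => by
    have hδ : ∀ k : ℕ, (0 : ℝ) < 1 / (k + 1) := fun k => Nat.one_div_pos_of_nat
    have hlim : ∀ (ρ : Measure ℝ) [IsProbabilityMeasure ρ], Filter.Tendsto
        (fun k : ℕ => ∫ x, (thickenedIndicator (hδ k) F x : ℝ) ∂ρ) Filter.atTop
        (nhds (ρ.real F)) := fun ρ _ => by
      have := tendsto_lintegral_thickenedIndicator_of_isClosed ρ hF hδ
        tendsto_one_div_add_atTop_nhds_zero_nat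
      have h2 := (ENNReal.tendsto_toReal (measure_ne_top ρ F)).comp this
      refine h2.congr fun k => ?_
      rw [Function.comp_apply, integral_eq_lintegral_of_nonneg_ae
        (Filter.Eventually.of_forall fun x => NNReal.coe_nonneg _)
        (Continuous.aestronglyMeasurable (by fun_prop))]
      simp
    refine le_of_tendsto' ((hlim P).sub (hlim Q)) fun k => hC _ (by fun_prop)
      (fun x => NNReal.coe_nonneg _) fun x => ?_
    exact_mod_cast thickenedIndicator_le_one (hδ k) F x
  refine le_of_forall_pos_le_add fun ε hε => ?_
  obtain ⟨F, hFs, hF, hlt⟩ := hs.exists_isClosed_lt_add (measure_ne_top P s)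
    (ENNReal.ofReal_pos.2 hε).ne'
  have h1 : P.real s ≤ P.real F + ε := by
    have := ENNReal.toReal_mono (by finiteness) hlt.le
    rwa [ENNReal.toReal_add (measure_ne_top P F) ENNReal.ofReal_ne_top,
      ENNReal.toReal_ofReal hε.le] at this
  have h2 : Q.real F ≤ Q.real s := measureReal_mono hFs
  linarith [hclosed F hF]

lemma dTV_le_of_forall_continuous {P Q : Measure ℝ} [IsProbabilityMeasure P]
    [IsProbabilityMeasure Q] {C : ℝ}
    (hC : ∀ h : ℝ → ℝ, Continuous h → (∀ x, 0 ≤ h x) → (∀ x, h x ≤ 1) →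
      ∫ x, h x ∂P - ∫ x, h x ∂Q ≤ C) : dTV P Q ≤ C := by
  have : Nonempty {s : Set ℝ // MeasurableSet s} := ⟨⟨∅, MeasurableSet.empty⟩⟩
  refine ciSup_le fun s => abs_sub_le_iff.2 ⟨measureReal_sub_le_of_forall_continuous hC s.2, ?_⟩
  have := measureReal_sub_le_of_forall_continuous hC s.2.compl
  rw [probReal_compl_eq_one_sub s.2, probReal_compl_eq_one_sub s.2] at this
  change Q.real s.1 - P.real s.1 ≤ C
  linarith

/-- Stein's method for the total variation distance to the standard Gaussian distribution. -/
lemma dTV_gaussianReal_le_of_stein {P : Measure ℝ} [IsProbabilityMeasure P] {C : ℝ}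
    (hC : ∀ g g' : ℝ → ℝ, (∀ x, HasDerivAt g (g' x) x) → Continuous g' →
      (∀ x, |g x| ≤ Real.sqrt (π / 2)) → (∀ x, |g' x| ≤ 2) →
      ∫ x, (g' x - x * g x) ∂P ≤ C) : dTV P (gaussianReal 0 1) ≤ C := by
  refine dTV_le_of_forall_continuous fun h hc hn hl => ?_
  have hint : ∀ (ρ : Measure ℝ) [IsProbabilityMeasure ρ], Integrable h ρ := fun ρ _ =>
    Integrable.of_bound hc.aestronglyMeasurable 1 (Filter.Eventually.of_forall fun x => by
      rw [Real.norm_eq_abs, abs_of_nonneg (hn x)]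
      exact hl x)
  set m := ∫ x, h x ∂(gaussianReal 0 1) with hm
  have hm0 : 0 ≤ m := integral_nonneg hn
  have hm1 : m ≤ 1 := by
    have := integral_mono (hint (gaussianReal 0 1)) (integrable_const 1) hl
    simpa using this
  obtain ⟨g, hg, hgb, hg'b⟩ := exists_stein_solution (h := fun x => h x - m) (by fun_prop)
    (fun x => abs_le.2 ⟨by linarith [hn x], by linarith [hl x]⟩)
    (by rw [integral_sub (hint _) (integrable_const _)]; simp [hm])
  have hgc : Continuous g := continuous_iff_continuousAt.2 fun x => (hg x).continuousAt
  have := hC g _ hg (by fun_prop) hgb hg'b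
  simp only [add_sub_cancel_left] at this
  rw [integral_sub (hint _) (integrable_const _)] at this
  simpa using this

end TotalVariation

section Torus

variable {n : ℕ}

instance torusMeasure.isProbabilityMeasure : IsProbabilityMeasure (torusMeasure n) := by
  refine ⟨?_⟩
  rw [torusMeasure, Measure.restrict_apply_univ, Real.volume_pi_Ico]
  simp

lemma torusMeasure_eq_restrict_Icc :
    torusMeasure n = volume.restrict (Set.Icc (0 : Fin n → ℝ) 1) :=
  Measure.restrict_congr_set Measure.univ_pi_Ico_ae_eq_Icc

lemma integrable_torusMeasure {f : (Fin n → ℝ) → ℝ} (hf : Continuous f) :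
    Integrable f (torusMeasure n) := by
  rw [torusMeasure_eq_restrict_Icc]
  exact hf.integrableOn_Icc

/-- Directional derivatives of a continuously differentiable `ℤ^n`-periodic function have zero
mean over the torus. -/
lemma integral_torusMeasure_lineDeriv_eq_zero {φ ψ : (Fin n → ℝ) → ℝ} {w : Fin n → ℝ}
    (hφ : ContDiff ℝ 1 φ) (hper : ∀ x i, φ (x + Pi.single i 1) = φ x)
    (hψ : ∀ x, HasLineDerivAt ℝ φ (ψ x) x w) : ∫ x, ψ x ∂(torusMeasure n) = 0 := by
  have hd : Differentiable ℝ φ := hφ.differentiable one_ne_zero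
  have hψ' : ∀ x, ψ x = fderiv ℝ φ x w := fun x => by
    rw [← (hψ x).lineDeriv, (hd x).lineDeriv_eq_fderiv]
  simp_rw [hψ', torusMeasure_eq_restrict_Icc]
  have hc : Continuous (fderiv ℝ φ) := hφ.continuous_fderiv one_ne_zero
  rcases n with _ | m
  · obtain rfl : w = 0 := Subsingleton.elim _ _
    simp only [map_zero, integral_zero]
  have key := integral_divergence_of_hasFDerivAt_off_countable' (0 : Fin (m + 1) → ℝ) 1
    (by intro i; simp) (fun i x => w i * φ x) (fun i x => w i • fderiv ℝ φ x) ∅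
    Set.countable_empty (fun i => (continuous_const.mul hφ.continuous).continuousOn)
    (fun x _ i => (hd x).hasFDerivAt.const_mul (w i))
    (Continuous.integrableOn_Icc (by fun_prop))
  have hface : ∀ (i : Fin (m + 1)) (x : Fin m → ℝ),
      φ (i.insertNth 1 x) = φ (i.insertNth 0 x) := fun i x => by
    rw [← hper (i.insertNth 0 x) i]
    congr 1
    ext j
    refine Fin.succAboveCases i ?_ (fun k => ?_) j <;> simp [Fin.succAbove_ne]
  have hw : ∀ x, fderiv ℝ φ x w = ∑ i, (w i • fderiv ℝ φ x) (Pi.single i 1) := fun x => by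
    conv_lhs => rw [← Finset.univ_sum_single w]
    rw [map_sum]
    refine sum_congr rfl fun i _ => ?_
    rw [_root_.smul_apply, ← map_smul]
    congr 1
    ext j
    by_cases h : j = i <;> simp [h]
  simp_rw [hw, key]
  simp [hface]

lemma hasLineDerivAt_dotProduct (k x w : Fin n → ℝ) :
    HasDerivAt (fun t : ℝ => 2 * π * (k ⬝ᵥ (x + t • w))) (2 * π * (k ⬝ᵥ w)) 0 := by
  simp only [dotProduct_add, dotProduct_smul, smul_eq_mul]
  simpa using (((hasDerivAt_id (0 : ℝ)).mul_const (k ⬝ᵥ w)).const_add (k ⬝ᵥ x)).const_mul (2 * π)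

lemma hasLineDerivAt_sin_dotProduct (k x w : Fin n → ℝ) :
    HasLineDerivAt ℝ (fun x => Real.sin (2 * π * (k ⬝ᵥ x)))
      (Real.cos (2 * π * (k ⬝ᵥ x)) * (2 * π * (k ⬝ᵥ w))) x w := by
  simpa [HasLineDerivAt] using (hasLineDerivAt_dotProduct k x w).sin

lemma hasLineDerivAt_cos_dotProduct (k x w : Fin n → ℝ) :
    HasLineDerivAt ℝ (fun x => Real.cos (2 * π * (k ⬝ᵥ x)))
      (-Real.sin (2 * π * (k ⬝ᵥ x)) * (2 * π * (k ⬝ᵥ w))) x w := by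
  simpa [HasLineDerivAt] using (hasLineDerivAt_dotProduct k x w).cos

lemma contDiff_dotProduct (k : Fin n → ℝ) {m : WithTop ℕ∞} :
    ContDiff ℝ m fun x : Fin n → ℝ => k ⬝ᵥ x := by
  unfold dotProduct
  fun_prop

/-- The vectors all of whose coordinates are integers. -/
def IsIntVec (k : Fin n → ℝ) : Prop := ∀ j, ∃ m : ℤ, k j = m

lemma IsIntVec.add {k l : Fin n → ℝ} (hk : IsIntVec k) (hl : IsIntVec l) : IsIntVec (k + l) :=
  fun j => by
    obtain ⟨a, ha⟩ := hk j
    obtain ⟨b, hb⟩ := hl j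
    exact ⟨a + b, by simp [ha, hb]⟩

lemma IsIntVec.sub {k l : Fin n → ℝ} (hk : IsIntVec k) (hl : IsIntVec l) : IsIntVec (k - l) :=
  fun j => by
    obtain ⟨a, ha⟩ := hk j
    obtain ⟨b, hb⟩ := hl j
    exact ⟨a - b, by simp [ha, hb]⟩

lemma IsIntVec.sin_add_single {k : Fin n → ℝ} (hk : IsIntVec k) (x : Fin n → ℝ) (i : Fin n) :
    Real.sin (2 * π * (k ⬝ᵥ (x + Pi.single i 1))) = Real.sin (2 * π * (k ⬝ᵥ x)) := by
  obtain ⟨m, hm⟩ := hk i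
  rw [← Real.sin_add_int_mul_two_pi (2 * π * (k ⬝ᵥ x)) m, dotProduct_add,
    dotProduct_single_one, hm]
  ring_nf

lemma IsIntVec.cos_add_single {k : Fin n → ℝ} (hk : IsIntVec k) (x : Fin n → ℝ) (i : Fin n) :
    Real.cos (2 * π * (k ⬝ᵥ (x + Pi.single i 1))) = Real.cos (2 * π * (k ⬝ᵥ x)) := by
  obtain ⟨m, hm⟩ := hk i
  rw [← Real.cos_add_int_mul_two_pi (2 * π * (k ⬝ᵥ x)) m, dotProduct_add,
    dotProduct_single_one, hm]
  ring_nf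

lemma IsIntVec.integral_cos_eq_zero {k : Fin n → ℝ} (hk : IsIntVec k) (h0 : k ≠ 0) :
    ∫ x, Real.cos (2 * π * (k ⬝ᵥ x)) ∂(torusMeasure n) = 0 := by
  have h := integral_torusMeasure_lineDeriv_eq_zero
    (φ := fun x => Real.sin (2 * π * (k ⬝ᵥ x)))
    (Real.contDiff_sin.comp (contDiff_const.mul (contDiff_dotProduct k))) hk.sin_add_single
    fun x => hasLineDerivAt_sin_dotProduct k x k
  rw [integral_mul_const] at h
  have hkk : k ⬝ᵥ k ≠ 0 := fun h => h0 (dotProduct_self_eq_zero.1 h)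
  exact (mul_eq_zero.1 h).resolve_right (by positivity)

lemma add_self_ne_zero_of_ne_zero {k : Fin n → ℝ} (hk : k ≠ 0) : k + k ≠ 0 := by
  rw [← two_smul ℝ]
  exact smul_ne_zero two_ne_zero hk

lemma continuous_cos_dotProduct (k : Fin n → ℝ) :
    Continuous fun x : Fin n → ℝ => Real.cos (2 * π * (k ⬝ᵥ x)) :=
  Real.continuous_cos.comp (continuous_const.mul (contDiff_dotProduct k (m := 0)).continuous)

lemma IsIntVec.integral_cos_sq {k : Fin n → ℝ} (hk : IsIntVec k) (h0 : k ≠ 0) :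
    ∫ x, Real.cos (2 * π * (k ⬝ᵥ x)) ^ 2 ∂(torusMeasure n) = 1 / 2 := by
  have h : ∀ x : Fin n → ℝ, Real.cos (2 * π * (k ⬝ᵥ x)) ^ 2 =
      1 / 2 + Real.cos (2 * π * ((k + k) ⬝ᵥ x)) / 2 := fun x => by
    rw [Real.cos_sq, add_dotProduct]
    ring_nf
  simp_rw [h]
  rw [integral_add (integrable_const _)
    ((integrable_torusMeasure (continuous_cos_dotProduct _)).div_const _), integral_div,
    integral_div, (hk.add hk).integral_cos_eq_zero (add_self_ne_zero_of_ne_zero h0)]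
  simp

lemma IsIntVec.integral_sin_sq {k : Fin n → ℝ} (hk : IsIntVec k) (h0 : k ≠ 0) :
    ∫ x, Real.sin (2 * π * (k ⬝ᵥ x)) ^ 2 ∂(torusMeasure n) = 1 / 2 := by
  have h : ∀ x : Fin n → ℝ, Real.sin (2 * π * (k ⬝ᵥ x)) ^ 2 =
      1 - Real.cos (2 * π * (k ⬝ᵥ x)) ^ 2 := fun x => Real.sin_sq _
  simp_rw [h]
  rw [integral_sub (integrable_const _)
    (integrable_torusMeasure ((continuous_cos_dotProduct k).fun_pow 2)), hk.integral_cos_sq h0]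
  norm_num

lemma IsIntVec.integral_sin_sq_mul_sin_sq {k l : Fin n → ℝ} (hk : IsIntVec k) (hl : IsIntVec l)
    (hk0 : k ≠ 0) (hl0 : l ≠ 0) (hkl0 : k + l ≠ 0)
    [Decidable (k = l)] :
    ∫ x, Real.sin (2 * π * (k ⬝ᵥ x)) ^ 2 * Real.sin (2 * π * (l ⬝ᵥ x)) ^ 2 ∂(torusMeasure n) =
      1 / 4 + if k = l then 1 / 8 else 0 := by
  have h : ∀ x : Fin n → ℝ,
      Real.sin (2 * π * (k ⬝ᵥ x)) ^ 2 * Real.sin (2 * π * (l ⬝ᵥ x)) ^ 2 =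
      1 / 4 - Real.cos (2 * π * ((k + k) ⬝ᵥ x)) / 4 - Real.cos (2 * π * ((l + l) ⬝ᵥ x)) / 4 +
        Real.cos (2 * π * ((k + l + (k + l)) ⬝ᵥ x)) / 8 +
        Real.cos (2 * π * ((k - l + (k - l)) ⬝ᵥ x)) / 8 := fun x => by
    simp only [add_dotProduct, sub_dotProduct]
    set a := 2 * π * (k ⬝ᵥ x)
    set b := 2 * π * (l ⬝ᵥ x)
    rw [show 2 * π * (k ⬝ᵥ x + k ⬝ᵥ x) = 2 * a by ring,
      show 2 * π * (l ⬝ᵥ x + l ⬝ᵥ x) = 2 * b by ring,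
      show 2 * π * (k ⬝ᵥ x + l ⬝ᵥ x + (k ⬝ᵥ x + l ⬝ᵥ x)) = 2 * a + 2 * b by ring,
      show 2 * π * (k ⬝ᵥ x - l ⬝ᵥ x + (k ⬝ᵥ x - l ⬝ᵥ x)) = 2 * a - 2 * b by ring,
      Real.cos_add, Real.cos_sub, Real.cos_two_mul, Real.cos_two_mul, Real.sin_sq, Real.sin_sq]
    ring
  have hi : ∀ (k : Fin n → ℝ) (c : ℝ), Integrable
      (fun x => Real.cos (2 * π * (k ⬝ᵥ x)) / c) (torusMeasure n) := fun k c =>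
    (integrable_torusMeasure (continuous_cos_dotProduct k)).div_const c
  have hmain : ∫ x, Real.sin (2 * π * (k ⬝ᵥ x)) ^ 2 * Real.sin (2 * π * (l ⬝ᵥ x)) ^ 2
      ∂(torusMeasure n) =
      1 / 4 + (∫ x, Real.cos (2 * π * ((k - l + (k - l)) ⬝ᵥ x)) ∂(torusMeasure n)) / 8 := by
    simp_rw [h]
    rw [integral_add (by fun_prop (disch := simp)) (hi _ _),
      integral_add (by fun_prop (disch := simp)) (hi _ _),
      integral_sub (by fun_prop (disch := simp)) (hi _ _),
      integral_sub (by fun_prop (disch := simp)) (hi _ _)]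
    simp only [integral_div, (hk.add hk).integral_cos_eq_zero (add_self_ne_zero_of_ne_zero hk0),
      (hl.add hl).integral_cos_eq_zero (add_self_ne_zero_of_ne_zero hl0),
      ((hk.add hl).add (hk.add hl)).integral_cos_eq_zero
        (add_self_ne_zero_of_ne_zero hkl0)]
    simp
  rw [hmain]
  split_ifs with hkl
  · simp [hkl]
  · rw [((hk.sub hl).add (hk.sub hl)).integral_cos_eq_zero
      (add_self_ne_zero_of_ne_zero (sub_ne_zero.2 hkl))]
    simp

end Torus

lemma integral_abs_le_sqrt_integral_sq {Ω : Type*} [MeasurableSpace Ω] {P : Measure Ω}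
    [IsProbabilityMeasure P] {f : Ω → ℝ} (hf : Integrable f P)
    (hf2 : Integrable (fun ω => f ω ^ 2) P) :
    ∫ ω, |f ω| ∂P ≤ Real.sqrt (∫ ω, f ω ^ 2 ∂P) := by
  set t := ∫ ω, |f ω| ∂P with ht
  have h0 : 0 ≤ ∫ ω, (|f ω| - t) ^ 2 ∂P := integral_nonneg fun ω => sq_nonneg _
  have h1 : ∀ ω, (|f ω| - t) ^ 2 = f ω ^ 2 - 2 * t * |f ω| + t ^ 2 := fun ω => by
    rw [← sq_abs (f ω)]
    ring
  simp_rw [h1] at h0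
  rw [integral_add (f := fun ω => f ω ^ 2 - 2 * t * |f ω|) (hf2.sub (hf.abs.const_mul _))
    (integrable_const _), integral_sub hf2 (hf.abs.const_mul _), integral_const_mul, ← ht] at h0
  simp at h0
  exact Real.le_sqrt_of_sq_le (by linarith)

section RandomWave

variable {n : ℕ} (B : Matrix (Fin n) (Fin n) ℝ) (𝒱 : Finset (Fin n → ℝ))

/-- The angle `2π⟨Bv,x⟩`. -/
noncomputable def waveAngle (v : ↥𝒱) (x : Fin n → ℝ) : ℝ := 2 * π * (B.mulVec v ⬝ᵥ x)

/-- The entries `(2π)²⟨Bv,w⟩` of the scaled Gram matrix of `𝒱`. -/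
noncomputable def waveGram (v w : ↥𝒱) : ℝ := (2 * π) ^ 2 * (B.mulVec v ⬝ᵥ w)

/-- The squared norm `‖∇_B f(x)‖_B²` as a quadratic form in the coefficients. -/
noncomputable def gradNormSq (a : ↥𝒱 → ℝ) (x : Fin n → ℝ) : ℝ :=
  ∑ v, ∑ w, (waveGram B 𝒱 v w * (Real.sin (waveAngle B 𝒱 v x) * Real.sin (waveAngle B 𝒱 w x))) *
    (a v * a w)

/-- The defect `-(Δ_B f + μ f)(x)`. -/
noncomputable def eigenDefect (μ : ℝ) (a : ↥𝒱 → ℝ) (x : Fin n → ℝ) : ℝ :=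
  ∑ v, (waveGram B 𝒱 v v - μ) * (a v * Real.cos (waveAngle B 𝒱 v x))

@[fun_prop]
lemma continuous_waveAngle (v : ↥𝒱) : Continuous (waveAngle B 𝒱 v) :=
  continuous_const.mul (contDiff_dotProduct _ (m := 0)).continuous

lemma torusFun_eq (a : ↥𝒱 → ℝ) (x : Fin n → ℝ) :
    torusFun B 𝒱 a x = ∑ v, a v * Real.cos (waveAngle B 𝒱 v x) := by
  rw [torusFun, Complex.re_sum]
  refine sum_congr rfl fun v _ => ?_
  rw [Complex.re_ofReal_mul, waveAngle, show 2 * (π : ℂ) * Complex.I *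
    ((B.mulVec v ⬝ᵥ x : ℝ) : ℂ) = ((2 * π * (B.mulVec v ⬝ᵥ x) : ℝ) : ℂ) * Complex.I by
      push_cast; ring, Complex.exp_ofReal_mul_I_re]

lemma continuous_torusFun (a : ↥𝒱 → ℝ) : Continuous (torusFun B 𝒱 a) := by
  rw [funext (torusFun_eq B 𝒱 a)]
  fun_prop

lemma continuous_gradNormSq (a : ↥𝒱 → ℝ) : Continuous (gradNormSq B 𝒱 a) := by
  unfold gradNormSq
  fun_prop

lemma continuous_eigenDefect (μ : ℝ) (a : ↥𝒱 → ℝ) : Continuous (eigenDefect B 𝒱 μ a) := by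
  unfold eigenDefect
  fun_prop

lemma contDiff_torusFun (a : ↥𝒱 → ℝ) : ContDiff ℝ 1 (torusFun B 𝒱 a) := by
  rw [funext (torusFun_eq B 𝒱 a)]
  exact ContDiff.sum fun v _ => contDiff_const.mul
    (Real.contDiff_cos.comp (contDiff_const.mul (contDiff_dotProduct _)))

lemma hasLineDerivAt_torusFun (a : ↥𝒱 → ℝ) (x w : Fin n → ℝ) :
    HasLineDerivAt ℝ (torusFun B 𝒱 a)
      (∑ v, a v * (-Real.sin (waveAngle B 𝒱 v x) * (2 * π * (B.mulVec v ⬝ᵥ w)))) x w := by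
  rw [funext (torusFun_eq B 𝒱 a)]
  exact HasDerivAt.fun_sum fun v _ =>
    (hasLineDerivAt_cos_dotProduct (B.mulVec v) x w).const_mul (a v)

variable {B 𝒱}

lemma torusFun_add_single (hint : ∀ v ∈ 𝒱, IsIntVec (B.mulVec v)) (a : ↥𝒱 → ℝ)
    (x : Fin n → ℝ) (i : Fin n) :
    torusFun B 𝒱 a (x + Pi.single i 1) = torusFun B 𝒱 a x := by
  simp only [torusFun_eq, waveAngle]
  exact sum_congr rfl fun v _ => by rw [(hint v v.2).cos_add_single]

/-- Integration by parts on the torus: `𝔼 g'(f) ‖∇f‖² = -𝔼 g(f) Δf`. -/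
lemma integral_torusMeasure_stein_identity (hint : ∀ v ∈ 𝒱, IsIntVec (B.mulVec v))
    (a : ↥𝒱 → ℝ) {g g' : ℝ → ℝ} (hg : ∀ y, HasDerivAt g (g' y) y) (hg' : Continuous g') :
    ∫ x, (g (torusFun B 𝒱 a x) * ∑ w, waveGram B 𝒱 w w * (a w * Real.cos (waveAngle B 𝒱 w x)) -
      g' (torusFun B 𝒱 a x) * gradNormSq B 𝒱 a x) ∂(torusMeasure n) = 0 := by
  have hf := continuous_torusFun B 𝒱 a
  have hgc : Continuous g := continuous_iff_continuousAt.2 fun x => (hg x).continuousAt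
  have hg1 : ContDiff ℝ 1 g := contDiff_one_iff_deriv.2
    ⟨fun x => (hg x).differentiableAt, by rwa [funext fun x => (hg x).deriv]⟩
  set ψ : ↥𝒱 → (Fin n → ℝ) → ℝ := fun w x =>
    (g' (torusFun B 𝒱 a x) * ∑ v, a v * (-Real.sin (waveAngle B 𝒱 v x) *
      (2 * π * (B.mulVec v ⬝ᵥ w)))) * Real.sin (waveAngle B 𝒱 w x) +
    g (torusFun B 𝒱 a x) * (Real.cos (waveAngle B 𝒱 w x) * (2 * π * (B.mulVec w ⬝ᵥ w))) with hψ
  have hψc : ∀ w, Continuous (ψ w) := fun w => by fun_prop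
  have hψ0 : ∀ w, ∫ x, ψ w x ∂(torusMeasure n) = 0 := fun w => by
    refine integral_torusMeasure_lineDeriv_eq_zero
      (φ := fun x => g (torusFun B 𝒱 a x) * Real.sin (waveAngle B 𝒱 w x)) (w := w)
      ((hg1.comp (contDiff_torusFun B 𝒱 a)).mul
        (Real.contDiff_sin.comp (contDiff_const.mul (contDiff_dotProduct _))))
      (fun x i => ?_) fun x => ?_
    · rw [torusFun_add_single hint, waveAngle, (hint w w.2).sin_add_single, waveAngle]
    · have h1 := hasLineDerivAt_torusFun B 𝒱 a x w
      have h2 := hasLineDerivAt_sin_dotProduct (B.mulVec w) x w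
      unfold HasLineDerivAt at h1 h2 ⊢
      have h3 := (HasDerivAt.comp (0 : ℝ) (hg _) h1).fun_mul h2
      simpa [hψ, waveAngle] using h3
  have hsum : ∀ x, g (torusFun B 𝒱 a x) *
      ∑ w, waveGram B 𝒱 w w * (a w * Real.cos (waveAngle B 𝒱 w x)) -
      g' (torusFun B 𝒱 a x) * gradNormSq B 𝒱 a x = ∑ w, (2 * π * a w) * ψ w x := fun x => by
    simp only [hψ, mul_add, sum_add_distrib, gradNormSq, waveGram]
    rw [sum_comm (s := univ) (t := univ), sub_eq_neg_add]
    congr 1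
    · simp only [mul_sum, sum_mul, ← sum_neg_distrib]
      exact sum_congr rfl fun w _ => sum_congr rfl fun v _ => by ring
    · rw [mul_sum]
      exact sum_congr rfl fun w _ => by ring
  simp_rw [hsum]
  rw [integral_finsetSum _ fun w _ => (integrable_torusMeasure (hψc w)).const_mul _]
  simp [integral_const_mul, hψ0]

/-- The bound on the total variation distance for fixed coefficients. -/
lemma dTV_torusFun_le (hint : ∀ v ∈ 𝒱, IsIntVec (B.mulVec v)) (a : ↥𝒱 → ℝ) {μ : ℝ}
    (hμ : 0 < μ) :
    dTV (Measure.map (torusFun B 𝒱 a) (torusMeasure n)) (gaussianReal 0 1) ≤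
      1 / μ * (2 * Real.sqrt (∫ x, (μ - gradNormSq B 𝒱 a x) ^ 2 ∂(torusMeasure n)) +
        Real.sqrt (π / 2) * Real.sqrt (∫ x, eigenDefect B 𝒱 μ a x ^ 2 ∂(torusMeasure n))) := by
  have hf := continuous_torusFun B 𝒱 a
  have hG := continuous_gradNormSq B 𝒱 a
  have hH := continuous_eigenDefect B 𝒱 μ a
  have := Measure.isProbabilityMeasure_map (μ := torusMeasure n) hf.measurable.aemeasurable
  refine dTV_gaussianReal_le_of_stein fun g g' hg hg' hgb hg'b => ?_
  have hgc : Continuous g := continuous_iff_continuousAt.2 fun x => (hg x).continuousAt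
  rw [integral_map hf.measurable.aemeasurable (Continuous.aestronglyMeasurable (by fun_prop))]
  have hid : ∀ x, g' (torusFun B 𝒱 a x) - torusFun B 𝒱 a x * g (torusFun B 𝒱 a x) =
      1 / μ * (g' (torusFun B 𝒱 a x) * (μ - gradNormSq B 𝒱 a x) +
        g (torusFun B 𝒱 a x) * eigenDefect B 𝒱 μ a x) -
      1 / μ * (g (torusFun B 𝒱 a x) *
        ∑ w, waveGram B 𝒱 w w * (a w * Real.cos (waveAngle B 𝒱 w x)) -
        g' (torusFun B 𝒱 a x) * gradNormSq B 𝒱 a x) := fun x => by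
    have : eigenDefect B 𝒱 μ a x = (∑ w, waveGram B 𝒱 w w *
        (a w * Real.cos (waveAngle B 𝒱 w x))) - μ * torusFun B 𝒱 a x := by
      rw [torusFun_eq, eigenDefect, mul_sum, ← sum_sub_distrib]
      exact sum_congr rfl fun v _ => by ring
    rw [this]
    field_simp
    ring
  have hGi : Integrable (fun x => μ - gradNormSq B 𝒱 a x) (torusMeasure n) :=
    integrable_torusMeasure (by fun_prop)
  have hHi := integrable_torusMeasure hH
  simp_rw [hid]
  rw [integral_sub (integrable_torusMeasure (by fun_prop))
    (integrable_torusMeasure (by fun_prop)), integral_const_mul, integral_const_mul,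
    integral_torusMeasure_stein_identity hint a hg hg', mul_zero, sub_zero]
  refine mul_le_mul_of_nonneg_left ?_ (by positivity)
  calc _ ≤ ∫ x, (2 * |μ - gradNormSq B 𝒱 a x| + Real.sqrt (π / 2) * |eigenDefect B 𝒱 μ a x|)
        ∂(torusMeasure n) := by
        refine integral_mono (integrable_torusMeasure (by fun_prop))
          (integrable_torusMeasure (by fun_prop)) fun x => ?_
        refine (le_abs_self _).trans ((abs_add_le _ _).trans ?_)
        rw [abs_mul, abs_mul]
        gcongr
        exacts [hg'b _, hgb _]
    _ = 2 * ∫ x, |μ - gradNormSq B 𝒱 a x| ∂(torusMeasure n) +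
        Real.sqrt (π / 2) * ∫ x, |eigenDefect B 𝒱 μ a x| ∂(torusMeasure n) := by
        rw [integral_add (hGi.abs.const_mul _) (hHi.abs.const_mul _), integral_const_mul,
          integral_const_mul]
    _ ≤ _ := by
        gcongr
        · exact integral_abs_le_sqrt_integral_sq hGi (integrable_torusMeasure (by fun_prop))
        · exact integral_abs_le_sqrt_integral_sq hHi (integrable_torusMeasure (by fun_prop))

end RandomWave

section Averaging

variable {n : ℕ} {𝒱 : Finset (Fin n → ℝ)} {B : Matrix (Fin n) (Fin n) ℝ}

lemma ae_coeffMeasure_mem_closedBall :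
    ∀ᵐ a ∂(coeffMeasure 𝒱), a ∈ Metric.closedBall (0 : ↥𝒱 → ℝ) (Real.sqrt 2) := by
  refine (ae_map_iff measurable_sqrt_two_mul_sphere.aemeasurable
    Metric.isClosed_closedBall.measurableSet).2 ?_
  refine Filter.Eventually.of_forall fun c => ?_
  rw [dist_zero_right, pi_norm_le_iff_of_nonneg (Real.sqrt_nonneg 2)]
  intro v
  rw [norm_mul, Real.norm_of_nonneg (Real.sqrt_nonneg 2)]
  refine mul_le_of_le_one_right (Real.sqrt_nonneg 2) ?_
  exact (PiLp.norm_apply_le (c : EuclideanSpace ℝ ↥𝒱) v).trans (norm_eq_of_mem_sphere c).le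

lemma waveGram_comm (hB : B.IsSymm) (v w : ↥𝒱) : waveGram B 𝒱 v w = waveGram B 𝒱 w v := by
  rw [waveGram, waveGram, dotProduct_comm, Matrix.dotProduct_mulVec, ← Matrix.mulVec_transpose,
    hB.eq]

lemma mulVec_ne_zero_of_injective (hB : Function.Injective B.mulVec)
    (hne : ∀ v ∈ 𝒱, ∀ w ∈ 𝒱, v + w ≠ 0) {v : Fin n → ℝ} (hv : v ∈ 𝒱) : B.mulVec v ≠ 0 := by
  rw [← Matrix.mulVec_zero B, hB.ne_iff]
  rintro rfl
  exact hne 0 hv 0 hv (add_zero 0)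

lemma mulVec_add_mulVec_ne_zero_of_injective (hB : Function.Injective B.mulVec)
    (hne : ∀ v ∈ 𝒱, ∀ w ∈ 𝒱, v + w ≠ 0) {v w : Fin n → ℝ} (hv : v ∈ 𝒱) (hw : w ∈ 𝒱) :
    B.mulVec v + B.mulVec w ≠ 0 := by
  rw [← Matrix.mulVec_add, ← Matrix.mulVec_zero B, hB.ne_iff]
  exact hne v hv w hw

variable [Nonempty ↥𝒱]

lemma integrable_coeffMeasure_prod_torusMeasure {F : (↥𝒱 → ℝ) × (Fin n → ℝ) → ℝ}
    (hF : Continuous F) : Integrable F ((coeffMeasure 𝒱).prod (torusMeasure n)) := by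
  rw [← Measure.restrict_eq_self_of_ae_mem (ae_coeffMeasure_mem_closedBall (𝒱 := 𝒱)),
    torusMeasure_eq_restrict_Icc, Measure.prod_restrict]
  exact hF.continuousOn.integrableOn_compact
    ((isCompact_closedBall _ _).prod isCompact_Icc)

lemma integral_coeffMeasure_sqrt_le {F : (↥𝒱 → ℝ) × (Fin n → ℝ) → ℝ} (hF : Continuous F) :
    Integrable (fun a => Real.sqrt (∫ x, F (a, x) ^ 2 ∂(torusMeasure n))) (coeffMeasure 𝒱) ∧
    ∫ a, Real.sqrt (∫ x, F (a, x) ^ 2 ∂(torusMeasure n)) ∂(coeffMeasure 𝒱) ≤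
      Real.sqrt (∫ x, ∫ a, F (a, x) ^ 2 ∂(coeffMeasure 𝒱) ∂(torusMeasure n)) := by
  have hP : Integrable (fun a => ∫ x, F (a, x) ^ 2 ∂(torusMeasure n)) (coeffMeasure 𝒱) :=
    (integrable_coeffMeasure_prod_torusMeasure (F := fun p => F p ^ 2)
      (by fun_prop)).integral_prod_left
  have hP0 : ∀ a, 0 ≤ ∫ x, F (a, x) ^ 2 ∂(torusMeasure n) := fun a =>
    integral_nonneg fun x => sq_nonneg _
  have hi : Integrable (fun a => Real.sqrt (∫ x, F (a, x) ^ 2 ∂(torusMeasure n)))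
      (coeffMeasure 𝒱) := by
    refine (hP.add (integrable_const 1)).mono'
      (Real.continuous_sqrt.comp_aestronglyMeasurable hP.1)
      (Filter.Eventually.of_forall fun a => ?_)
    rw [Real.norm_of_nonneg (Real.sqrt_nonneg _), Pi.add_apply]
    exact Real.sqrt_le_iff.2 ⟨by linarith [hP0 a], by nlinarith [hP0 a]⟩
  refine ⟨hi, ?_⟩
  have hsq : ∀ a, Real.sqrt (∫ x, F (a, x) ^ 2 ∂(torusMeasure n)) ^ 2 =
      ∫ x, F (a, x) ^ 2 ∂(torusMeasure n) := fun a => Real.sq_sqrt (hP0 a)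
  have h := integral_abs_le_sqrt_integral_sq hi (by simpa only [hsq] using hP)
  simp only [hsq, abs_of_nonneg (Real.sqrt_nonneg _)] at h
  rwa [integral_integral_swap (f := fun a x => F (a, x) ^ 2)
    (integrable_coeffMeasure_prod_torusMeasure (F := fun p => F p ^ 2) (by fun_prop))] at h

lemma integral_eigenDefect_sq (hint : ∀ v ∈ 𝒱, IsIntVec (B.mulVec v))
    (hB : Function.Injective B.mulVec) (hne : ∀ v ∈ 𝒱, ∀ w ∈ 𝒱, v + w ≠ 0) (μ : ℝ) :
    ∫ x, ∫ a, eigenDefect B 𝒱 μ a x ^ 2 ∂(coeffMeasure 𝒱) ∂(torusMeasure n) =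
      1 / #𝒱 * ∑ v, (waveGram B 𝒱 v v - μ) ^ 2 := by
  classical
  have h : ∀ a x, eigenDefect B 𝒱 μ a x ^ 2 = ∑ v, ∑ w,
      ((waveGram B 𝒱 v v - μ) * Real.cos (waveAngle B 𝒱 v x) *
        ((waveGram B 𝒱 w w - μ) * Real.cos (waveAngle B 𝒱 w x))) * (a v * a w) := fun a x => by
    rw [eigenDefect, sq, sum_mul_sum]
    exact sum_congr rfl fun v _ => sum_congr rfl fun w _ => by ring
  simp_rw [h, integral_coeffMeasure_quadratic, integral_const_mul]
  rw [integral_finsetSum _ fun v _ => integrable_torusMeasure (by fun_prop)]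
  have h2 : ∀ v : ↥𝒱, ∫ x, (waveGram B 𝒱 v v - μ) * Real.cos (waveAngle B 𝒱 v x) *
      ((waveGram B 𝒱 v v - μ) * Real.cos (waveAngle B 𝒱 v x)) ∂(torusMeasure n) =
      (waveGram B 𝒱 v v - μ) ^ 2 / 2 := fun v => by
    have h3 := (hint v v.2).integral_cos_sq (mulVec_ne_zero_of_injective hB hne v.2)
    have h4 : ∀ x, (waveGram B 𝒱 v v - μ) * Real.cos (waveAngle B 𝒱 v x) *
        ((waveGram B 𝒱 v v - μ) * Real.cos (waveAngle B 𝒱 v x)) =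
        (waveGram B 𝒱 v v - μ) ^ 2 * Real.cos (2 * π * (B.mulVec v ⬝ᵥ x)) ^ 2 := fun x => by
      rw [waveAngle]
      ring
    simp_rw [h4, integral_const_mul, h3]
    ring
  simp_rw [h2, ← sum_div]
  ring

lemma integral_sub_gradNormSq_sq (hBs : B.IsSymm) (hint : ∀ v ∈ 𝒱, IsIntVec (B.mulVec v))
    (hB : Function.Injective B.mulVec) (hne : ∀ v ∈ 𝒱, ∀ w ∈ 𝒱, v + w ≠ 0) (μ : ℝ) :
    ∫ x, ∫ a, (μ - gradNormSq B 𝒱 a x) ^ 2 ∂(coeffMeasure 𝒱) ∂(torusMeasure n) =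
      μ ^ 2 - 2 * μ * (1 / #𝒱 * ∑ v, waveGram B 𝒱 v v) + 1 / (#𝒱 * (#𝒱 + 2)) *
        ((∑ v, waveGram B 𝒱 v v) ^ 2 + 2 * ∑ v, ∑ w, waveGram B 𝒱 v w ^ 2 +
          3 / 2 * ∑ v, waveGram B 𝒱 v v ^ 2) := by
  classical
  set M := waveGram B 𝒱 with hM
  set s : ↥𝒱 → (Fin n → ℝ) → ℝ := fun v x => Real.sin (waveAngle B 𝒱 v x) with hs
  have hsc : ∀ v, Continuous (s v) := fun v => by fun_prop
  have hs2 : ∀ v, ∫ x, s v x ^ 2 ∂(torusMeasure n) = 1 / 2 := fun v =>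
    (hint v v.2).integral_sin_sq (mulVec_ne_zero_of_injective hB hne v.2)
  have hs4 : ∀ v w, ∫ x, s v x ^ 2 * s w x ^ 2 ∂(torusMeasure n) =
      1 / 4 + if v = w then 1 / 8 else 0 := fun v w => by
    refine ((hint v v.2).integral_sin_sq_mul_sin_sq (hint w w.2)
      (mulVec_ne_zero_of_injective hB hne v.2) (mulVec_ne_zero_of_injective hB hne w.2)
      (mulVec_add_mulVec_ne_zero_of_injective hB hne v.2 w.2)).trans ?_
    simp only [hB.eq_iff, Subtype.ext_iff]
  have hinner : ∀ x, ∫ a, (μ - gradNormSq B 𝒱 a x) ^ 2 ∂(coeffMeasure 𝒱) =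
      μ ^ 2 - 2 * μ * (2 / #𝒱 * ∑ v, M v v * s v x ^ 2) + 4 / (#𝒱 * (#𝒱 + 2)) *
        ∑ v, ∑ w, (M v v * M w w + 2 * M v w ^ 2) * (s v x ^ 2 * s w x ^ 2) := fun x => by
    have hc : Continuous fun a => gradNormSq B 𝒱 a x := by
      unfold gradNormSq
      fun_prop
    have h1 := integral_coeffMeasure_quadratic fun v w => M v w * (s v x * s w x)
    have h2 := integral_coeffMeasure_quadratic_sq (fun v w => M v w * (s v x * s w x))
      fun v w => by rw [hM, waveGram_comm hBs, mul_comm (s v x)]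
    change ∫ a, gradNormSq B 𝒱 a x ∂_ = _ at h1
    change ∫ a, gradNormSq B 𝒱 a x ^ 2 ∂_ = _ at h2
    have h3 : ∀ a, (μ - gradNormSq B 𝒱 a x) ^ 2 =
        μ ^ 2 - 2 * μ * gradNormSq B 𝒱 a x + gradNormSq B 𝒱 a x ^ 2 := fun a => by ring
    simp_rw [h3]
    rw [integral_add (integrable_coeffMeasure (by fun_prop))
      (integrable_coeffMeasure (by fun_prop)), integral_sub (integrable_const _)
      (integrable_coeffMeasure (by fun_prop)), integral_const_mul, h1, h2]
    simp only [integral_const, probReal_univ, one_smul]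
    congr 2
    · simp only [sq]
    · rw [sq, sum_mul_sum, mul_sum, ← sum_add_distrib]
      refine sum_congr rfl fun v _ => ?_
      rw [mul_sum, ← sum_add_distrib]
      exact sum_congr rfl fun w _ => by ring
  simp_rw [hinner]
  rw [integral_add (integrable_torusMeasure (by fun_prop))
      (integrable_torusMeasure (by fun_prop)), integral_sub (integrable_const _)
      (integrable_torusMeasure (by fun_prop)), integral_const_mul, integral_const_mul,
      integral_const_mul, integral_finsetSum _ fun v _ => integrable_torusMeasure (by fun_prop),
      integral_finsetSum _ fun v _ => integrable_torusMeasure (by fun_prop)]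
  simp_rw [fun v => integral_finsetSum (μ := torusMeasure n) univ fun w _ =>
    integrable_torusMeasure
      (f := fun x => (M v v * M w w + 2 * M v w ^ 2) * (s v x ^ 2 * s w x ^ 2)) (by fun_prop),
    integral_const_mul, hs2, hs4]
  simp only [integral_const, probReal_univ, one_smul, mul_add, sum_add_distrib, mul_ite, mul_zero,
    sum_ite_eq, mem_univ, if_true, ← sum_mul, ← mul_sum]
  simp only [add_mul, ← sq]
  ring

lemma integral_sub_gradNormSq_sq_le (hBs : B.IsSymm) (hint : ∀ v ∈ 𝒱, IsIntVec (B.mulVec v))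
    (hB : Function.Injective B.mulVec) (hne : ∀ v ∈ 𝒱, ∀ w ∈ 𝒱, v + w ≠ 0) (μ : ℝ) :
    ∫ x, ∫ a, (μ - gradNormSq B 𝒱 a x) ^ 2 ∂(coeffMeasure 𝒱) ∂(torusMeasure n) ≤
      2 / (#𝒱 * (#𝒱 + 2)) * ∑ v, ∑ w, waveGram B 𝒱 v w ^ 2 +
        1 / #𝒱 * ∑ v, (waveGram B 𝒱 v v - μ) ^ 2 := by
  rw [integral_sub_gradNormSq_sq hBs hint hB hne]
  have hN : (0 : ℝ) < #𝒱 := by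
    rw [← Fintype.card_coe]
    exact_mod_cast Fintype.card_pos
  have hT := sq_sum_le_card_mul_sum_sq (s := univ) (f := fun v => waveGram B 𝒱 v v)
  have hQ : 0 ≤ ∑ v, waveGram B 𝒱 v v ^ 2 := sum_nonneg fun v _ => sq_nonneg _
  have hD : ∑ v, (waveGram B 𝒱 v v - μ) ^ 2 = ∑ v, waveGram B 𝒱 v v ^ 2 -
      2 * μ * ∑ v, waveGram B 𝒱 v v + #𝒱 * μ ^ 2 := by
    simp only [sub_sq, sum_add_distrib, sum_sub_distrib, mul_sum, sum_const, card_univ,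
      Fintype.card_coe, nsmul_eq_mul]
    congr 2
    exact sum_congr rfl fun v _ => by ring
  rw [card_univ, Fintype.card_coe] at hT
  rw [hD]
  set T := ∑ v, waveGram B 𝒱 v v
  set Q := ∑ v, waveGram B 𝒱 v v ^ 2
  set S := ∑ v, ∑ w, waveGram B 𝒱 v w ^ 2
  rw [← sub_nonneg]
  have h : 2 / (#𝒱 * (#𝒱 + 2)) * S + 1 / #𝒱 * (Q - 2 * μ * T + #𝒱 * μ ^ 2) -
      (μ ^ 2 - 2 * μ * (1 / #𝒱 * T) + 1 / (#𝒱 * (#𝒱 + 2)) * (T ^ 2 + 2 * S + 3 / 2 * Q)) =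
      (#𝒱 * Q - T ^ 2 + Q / 2) / (#𝒱 * (#𝒱 + 2)) := by
    field_simp
    ring
  rw [h]
  exact div_nonneg (by linarith) (by positivity)

lemma integral_dTV_torusFun_le (hBs : B.IsSymm) (hint : ∀ v ∈ 𝒱, IsIntVec (B.mulVec v))
    (hB : Function.Injective B.mulVec) (hne : ∀ v ∈ 𝒱, ∀ w ∈ 𝒱, v + w ≠ 0) {μ : ℝ} (hμ : 0 < μ) :
    ∫ a, dTV (Measure.map (torusFun B 𝒱 a) (torusMeasure n)) (gaussianReal 0 1)
        ∂(coeffMeasure 𝒱) ≤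
      1 / μ * (2 * Real.sqrt (2 / (#𝒱 * (#𝒱 + 2)) * ∑ v, ∑ w, waveGram B 𝒱 v w ^ 2 +
          1 / #𝒱 * ∑ v, (waveGram B 𝒱 v v - μ) ^ 2) +
        Real.sqrt (π / 2) * Real.sqrt (1 / #𝒱 * ∑ v, (waveGram B 𝒱 v v - μ) ^ 2)) := by
  obtain ⟨hi1, hle1⟩ := integral_coeffMeasure_sqrt_le (𝒱 := 𝒱)
    (F := fun p => μ - gradNormSq B 𝒱 p.1 p.2) (by unfold gradNormSq; fun_prop)
  obtain ⟨hi2, hle2⟩ := integral_coeffMeasure_sqrt_le (𝒱 := 𝒱)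
    (F := fun p => eigenDefect B 𝒱 μ p.1 p.2) (by unfold eigenDefect; fun_prop)
  rw [integral_eigenDefect_sq hint hB hne] at hle2
  replace hle1 := hle1.trans
    (Real.sqrt_le_sqrt (integral_sub_gradNormSq_sq_le hBs hint hB hne μ))
  refine (integral_mono_of_nonneg
    (Filter.Eventually.of_forall fun a => Real.iSup_nonneg fun s => abs_nonneg _)
    (((hi1.const_mul 2).add (hi2.const_mul (Real.sqrt (π / 2)))).const_mul (1 / μ))
    (Filter.Eventually.of_forall fun a => dTV_torusFun_le hint a hμ)).trans ?_
  rw [integral_const_mul]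
  refine mul_le_mul_of_nonneg_left ?_ (by positivity)
  rw [integral_add' (hi1.const_mul 2) (hi2.const_mul _), integral_const_mul, integral_const_mul]
  gcongr

end Averaging

section

theorem stmt4 (n : ℕ) (B : Matrix (Fin n) (Fin n) ℝ)
    (hBsymm : B.IsSymm) (hBpos : B.PosDef)
    (𝒱 : Finset (Fin n → ℝ)) (h𝒱 : 𝒱.Nonempty)
    (hint : ∀ v ∈ 𝒱, ∀ j, ∃ m : ℤ, B.mulVec v j = (m : ℝ))
    (hne : ∀ v ∈ 𝒱, ∀ w ∈ 𝒱, v + w ≠ 0)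
    (μ : ℝ) (hμ : 0 < μ) :
    (∫ a, dTV (MeasureTheory.Measure.map (torusFun B 𝒱 a) (torusMeasure n))
        (gaussianReal 0 1) ∂(coeffMeasure 𝒱))
      ≤ (1 / μ) *
        (Real.sqrt ((8 * (2 * π) ^ 4 / ((𝒱.card : ℝ) * ((𝒱.card : ℝ) + 2))) *
            ∑ v ∈ 𝒱, ∑ w ∈ 𝒱, (B.mulVec v ⬝ᵥ w) ^ 2) +
          (2 * Real.sqrt 2 + Real.sqrt π) *
            Real.sqrt ((1 / (𝒱.card : ℝ)) *
              ∑ v ∈ 𝒱, ((2 * π) ^ 2 * normBsq B v - μ) ^ 2)) := by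
  have := h𝒱.to_subtype
  refine (integral_dTV_torusFun_le hBsymm hint
    (Matrix.mulVec_injective_of_isUnit hBpos.isUnit) hne hμ).trans
    (mul_le_mul_of_nonneg_left ?_ (by positivity))
  have hD : ∑ v ∈ 𝒱, ((2 * π) ^ 2 * normBsq B v - μ) ^ 2 =
      ∑ v, (waveGram B 𝒱 v v - μ) ^ 2 :=
    (sum_coe_sort 𝒱 fun v => ((2 * π) ^ 2 * normBsq B v - μ) ^ 2).symm
  have hS : (2 * π) ^ 4 * ∑ v ∈ 𝒱, ∑ w ∈ 𝒱, (B.mulVec v ⬝ᵥ w) ^ 2 =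
      ∑ v, ∑ w, waveGram B 𝒱 v w ^ 2 := by
    simp only [waveGram, mul_pow ((2 * π) ^ 2), ← pow_mul, ← mul_sum]
    rw [sum_coe_sort 𝒱 fun v => ∑ w : ↥𝒱, (B.mulVec v ⬝ᵥ w) ^ 2]
    simp only [fun v => sum_coe_sort 𝒱 fun w => (B.mulVec v ⬝ᵥ w) ^ 2]
  rw [hD, show ∀ c : ℝ, 8 * (2 * π) ^ 4 / c * ∑ v ∈ 𝒱, ∑ w ∈ 𝒱, (B.mulVec v ⬝ᵥ w) ^ 2 =
    2 ^ 2 * (2 / c * ((2 * π) ^ 4 * ∑ v ∈ 𝒱, ∑ w ∈ 𝒱, (B.mulVec v ⬝ᵥ w) ^ 2)) from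
    fun c => by ring, hS, Real.sqrt_mul (sq_nonneg 2), Real.sqrt_sq zero_le_two]
  set A := 2 / ((#𝒱 : ℝ) * (#𝒱 + 2)) * ∑ v, ∑ w, waveGram B 𝒱 v w ^ 2
  set D := 1 / (#𝒱 : ℝ) * ∑ v, (waveGram B 𝒱 v v - μ) ^ 2
  have hA : 0 ≤ A := by positivity
  have hD0 : 0 ≤ D := by positivity
  have h1 : Real.sqrt (A + D) ≤ Real.sqrt A + Real.sqrt D := by
    refine Real.sqrt_le_iff.2 ⟨by positivity, ?_⟩
    nlinarith [Real.sq_sqrt hA, Real.sq_sqrt hD0,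
      mul_nonneg (Real.sqrt_nonneg A) (Real.sqrt_nonneg D)]
  have h2 : Real.sqrt (π / 2) ≤ Real.sqrt π := Real.sqrt_le_sqrt (by linarith [Real.pi_pos])
  have h3 : 1 ≤ Real.sqrt 2 := Real.one_le_sqrt.2 one_le_two
  nlinarith [mul_le_mul_of_nonneg_right h2 (Real.sqrt_nonneg D),
    mul_le_mul_of_nonneg_right h3 (Real.sqrt_nonneg D)]

end
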